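/- Let w₁, w₂ be nonzero complex numbers with w₁/w₂ ∉ ℝ and Γ = {n·w₁ + m·w₂ : n, m ∈ ℤ}, and let P(z) = 1/z² + Σ_{w ∈ Γ\{0}} [1/(z−w)² − 1/w²]. Then P is doubly periodic with periods w₁ and w₂: for every z ∈ ℂ with z ∉ Γ, P(z + w₁) = P(z) and P(z + w₂) = P(z). -/

import Mathlib

/-- The lattice generated by `w₁` and `w₂`. -/
def latticeSet (w₁ w₂ : ℂ) : Set ℂ := {z : ℂ | ∃ n m : ℤ, z = (n : ℂ) * w₁ + (m : ℂ) * w₂}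

/-- The classical Weierstrass `P`-function:
`P z = 1/z² + Σ_{w ∈ Γ\{0}} (1/(z-w)² - 1/w²)`. -/
noncomputable def weierstrassP (w₁ w₂ : ℂ) (z : ℂ) : ℂ :=
  1 / z ^ 2 +
    ∑' w : {w : ℂ // w ∈ latticeSet w₁ w₂ ∧ w ≠ 0}, (1 / (z - (w : ℂ)) ^ 2 - 1 / (w : ℂ) ^ 2)

/-- The summand of the Weierstrass series at `w = 0` is `1 / z ^ 2`, so the classical `P`-function
is Mathlib's `℘`, summed over the full lattice. -/
theorem weierstrassP_eq_periodPair (L : PeriodPair) (z : ℂ) :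
    weierstrassP L.ω₁ L.ω₂ z = L.weierstrassP z := by
  have hmem (w : ℂ) : w ∈ latticeSet L.ω₁ L.ω₂ ↔ w ∈ L.lattice := by
    simp only [latticeSet, Set.mem_ofPred_eq, PeriodPair.mem_lattice, eq_comm]
  let f : ℂ → ℂ := fun w ↦ 1 / (z - w) ^ 2 - 1 / w ^ 2
  have hsum : Summable ((L.lattice : Set ℂ).indicator f) :=
    summable_subtype_iff_indicator.mp (L.hasSum_weierstrassP z).summable
  have hP : L.weierstrassP z = ∑' w, (L.lattice : Set ℂ).indicator f w :=
    tsum_subtype (L.lattice : Set ℂ) f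
  have hQ : ∑' w : {w : ℂ // w ∈ latticeSet L.ω₁ L.ω₂ ∧ w ≠ 0}, f w =
      ∑' w, {w : ℂ | w ∈ latticeSet L.ω₁ L.ω₂ ∧ w ≠ 0}.indicator f w :=
    tsum_subtype {w : ℂ | w ∈ latticeSet L.ω₁ L.ω₂ ∧ w ≠ 0} f
  rw [hP, hsum.tsum_eq_add_tsum_ite 0, weierstrassP, hQ]
  congr 1
  · simp [f]
  · classical
    refine tsum_congr fun w ↦ ?_
    by_cases hw : w = 0 <;> simp [Set.indicator_apply, hmem, hw]

/-- Two complex numbers with non-real ratio form a period pair. -/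
theorem linearIndependent_of_div_notMem_range_ofReal {w₁ w₂ : ℂ} (hw₂ : w₂ ≠ 0)
    (hratio : w₁ / w₂ ∉ Set.range ((↑) : ℝ → ℂ)) : LinearIndependent ℝ ![w₁, w₂] := by
  rw [LinearIndependent.pair_symm_iff, LinearIndependent.pair_iff' hw₂]
  rintro a rfl
  exact hratio ⟨a, by simp [hw₂]⟩

theorem weierstrassP_doubly_periodic (w₁ w₂ : ℂ) (hw₁ : w₁ ≠ 0) (hw₂ : w₂ ≠ 0)
    (hratio : w₁ / w₂ ∉ Set.range ((↑) : ℝ → ℂ))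
    (z : ℂ) (hz : z ∉ latticeSet w₁ w₂) :
    weierstrassP w₁ w₂ (z + w₁) = weierstrassP w₁ w₂ z ∧
    weierstrassP w₁ w₂ (z + w₂) = weierstrassP w₁ w₂ z := by
  let L : PeriodPair := ⟨w₁, w₂, linearIndependent_of_div_notMem_range_ofReal hw₂ hratio⟩
  have hP (x : ℂ) : weierstrassP w₁ w₂ x = L.weierstrassP x := weierstrassP_eq_periodPair L x
  simp only [hP]
  exact ⟨L.weierstrassP_add_coe z ⟨w₁, L.ω₁_mem_lattice⟩,
    L.weierstrassP_add_coe z ⟨w₂, L.ω₂_mem_lattice⟩⟩
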